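/- arXiv:2412.20095 — 3 statements merged into one kernel-verified Lean document; each statement's English description precedes it below -/
import Mathlib

section
/- If a finite group has a conjugacy class whose cardinality is a prime power greater than 1, then the group is not simple (Burnside's class theorem). -/
open scoped MatrixGroups

/-- The size of the conjugacy class of `x`. -/
noncomputable def classSize {G : Type*} [Group G] (x : G) : ℕ :=
  Nat.card {y : G // IsConj x y}

/-- `u_G(n)`: the number of elements of `G` whose conjugacy class has size `n`. -/
noncomputable def sameSizeCount (G : Type*) [Group G] (n : ℕ) : ℕ :=
  Nat.card {x : G // classSize x = n}

/-- `U(G)`: the same-size conjugacy class set of `G`. -/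
def sameSizeSet (G : Type*) [Group G] : Set ℕ :=
  {m | ∃ x : G, m = sameSizeCount G (classSize x)}

open Polynomial

lemma aux_roots {ι : Type*} [Fintype ι] [Nonempty ι] (r : ι → ℂ) (n : ℕ) (hn : 0 < n)
    (hr : ∀ i, r i ^ n = 1) (hint : IsIntegral ℤ ((∑ i, r i) / (Fintype.card ι : ℂ)))
    (h0 : ∑ i, r i ≠ 0) : ∀ i, r i = (∑ i, r i) / (Fintype.card ι : ℂ) := by
  set d : ℂ := (Fintype.card ι : ℂ) with hd
  have hd0 : d ≠ 0 := by simp [hd]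
  set α := (∑ i, r i) / d with hα
  have hα0 : α ≠ 0 := div_ne_zero h0 hd0
  have hri : ∀ i, IsIntegral ℚ (r i) := fun i => by
    refine IsIntegral.of_pow hn ?_
    rw [hr i]; exact isIntegral_one
  let K := IntermediateField.adjoin ℚ (Set.range r)
  have hfin : FiniteDimensional ℚ K := by
    apply IntermediateField.finiteDimensional_adjoin
    rintro _ ⟨i, rfl⟩
    exact hri i
  have : NumberField K := { to_charZero := inferInstance, to_finiteDimensional := hfin }
  let s : ι → K := fun i => ⟨r i, IntermediateField.subset_adjoin _ _ ⟨i, rfl⟩⟩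
  have hs : ∀ i, s i ^ n = 1 := fun i => Subtype.ext (by simpa [s] using hr i)
  let a : K := (∑ i, s i) / (Fintype.card ι : K)
  have haα : (a : ℂ) = α := by simp [a, s, hα, hd]
  have ha0 : a ≠ 0 := fun h => hα0 (by rw [← haα, h]; rfl)
  have hai : IsIntegral ℤ a := by
    rw [← haα] at hint
    exact (isIntegral_algebraMap_iff (A := K) (B := ℂ) (algebraMap K ℂ).injective).1 hint
  have hno : ∀ z : ℂ, z ^ n = 1 → ‖z‖ = 1 := fun z hz => Complex.norm_eq_one_of_pow_eq_one hz hn.ne'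
  obtain ⟨m, hm, ham⟩ := NumberField.Embeddings.pow_eq_one_of_norm_le_one K ℂ ha0 hai (by
    intro φ
    have : φ a = (∑ i, φ (s i)) / d := by simp [a, hd]
    rw [this, norm_div, div_le_one (by simpa using hd0)]
    refine (norm_sum_le _ _).trans ?_
    have : ∀ i, ‖φ (s i)‖ = 1 := fun i => hno _ (by rw [← map_pow, hs, map_one])
    simp [this, hd])
  have hαm : α ^ m = 1 := by rw [← haα]; exact_mod_cast congrArg (algebraMap K ℂ) ham
  have hα1 : ‖α‖ = 1 := Complex.norm_eq_one_of_pow_eq_one hαm hm.ne'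
  have hb : ∀ i, ‖r i / α‖ = 1 := fun i => by rw [norm_div, hno _ (hr i), hα1, div_one]
  have hsum : ∑ i, (1 - (r i / α).re) = 0 := by
    have h1 : ∑ i, r i / α = d := by
      rw [← Finset.sum_div]; field_simp; rw [hα]; field_simp
    have := congrArg Complex.re h1
    rw [Complex.re_sum] at this
    rw [Finset.sum_sub_distrib, this]; simp [hd]
  rw [Finset.sum_eq_zero_iff_of_nonneg] at hsum
  · intro i
    have h1 : (r i / α).re = 1 := by linarith [hsum i (Finset.mem_univ i)]
    have h2 : (r i / α).im = 0 := by
      have := Complex.sq_norm (r i / α)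
      rw [hb, Complex.normSq_apply, h1] at this
      nlinarith
    have : r i / α = 1 := Complex.ext (by simpa using h1) (by simpa using h2)
    rwa [div_eq_one_iff_eq hα0] at this
  · intro i _
    have := Complex.re_le_norm (r i / α)
    rw [hb] at this; linarith

lemma aux_mat_root {d : ℕ} (M : Matrix (Fin d) (Fin d) ℂ) (n : ℕ) (hM : M ^ n = 1)
    (z : ℂ) (hz : z ∈ M.charpoly.roots) : z ^ n = 1 := by
  have h1 : M.charpoly.IsRoot z := (mem_roots'.1 hz).2
  have hs : z ∈ spectrum ℂ M := Matrix.mem_spectrum_of_isRoot_charpoly h1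
  have hz : Nonempty (Fin d) := by
    by_contra h
    rw [not_nonempty_iff] at h
    simp [Matrix.charpoly, Matrix.charmatrix] at h1
  have h2 := spectrum.pow_mem_pow M n hs
  rw [hM, spectrum.one_eq] at h2
  simpa using h2

lemma aux_trace_int {d : ℕ} (M : Matrix (Fin d) (Fin d) ℂ) (n : ℕ) (hn : 0 < n) (hM : M ^ n = 1) :
    IsIntegral ℤ M.trace := by
  rw [Matrix.trace_eq_sum_roots_charpoly]
  refine IsIntegral.multiset_sum fun z hz => ?_
  refine IsIntegral.of_pow hn ?_
  rw [aux_mat_root M n hM z hz]; exact isIntegral_one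

lemma aux_scalar {d : ℕ} (hd : 0 < d) (M : Matrix (Fin d) (Fin d) ℂ) (n : ℕ) (hn : 0 < n)
    (hM : M ^ n = 1) (hint : IsIntegral ℤ (M.trace / d)) (h0 : M.trace ≠ 0) :
    M = algebraMap ℂ _ (M.trace / d) := by
  have hcard : M.charpoly.roots.card = d := by
    rw [← (IsAlgClosed.splits M.charpoly).natDegree_eq_card_roots, Matrix.charpoly_natDegree_eq_dim, Fintype.card_fin]
  let l := M.charpoly.roots.toList
  have hl : l.length = d := by simp [l, hcard]
  have hsum : ∑ i, l.get i = M.trace := by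
    rw [Matrix.trace_eq_sum_roots_charpoly, ← Multiset.sum_toList, ← List.sum_ofFn]
    rw [List.ofFn_get]
  have : Nonempty (Fin l.length) := ⟨⟨0, by omega⟩⟩
  have key := aux_roots l.get n hn (fun i => aux_mat_root M n hM _ (by
    rw [← Multiset.mem_toList]; exact List.get_mem _ _)) (by
      rw [hsum, Fintype.card_fin, hl]; exact hint) (by rw [hsum]; exact h0)
  have hl2 : (l.length : ℂ) = d := by rw [hl]
  rw [hsum, Fintype.card_fin, hl2] at key
  set α := M.trace / d
  have hrep : M.charpoly.roots = Multiset.replicate d α := by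
    rw [Multiset.eq_replicate]
    refine ⟨hcard, fun b hb => ?_⟩
    rw [← Multiset.mem_toList] at hb
    obtain ⟨i, rfl⟩ := List.get_of_mem hb
    exact key i
  have hch : M.charpoly = (X - C α) ^ d := by
    have := (IsAlgClosed.splits M.charpoly).eq_prod_roots_of_monic M.charpoly_monic
    rw [this, hrep]; simp
  have hsq : Squarefree (minpoly ℂ M) := by
    have : (X ^ n - 1 : ℂ[X]).Separable := (X_pow_sub_one_separable_iff (F := ℂ)).2 (by exact_mod_cast hn.ne')
    refine this.squarefree.squarefree_of_dvd (minpoly.dvd _ _ ?_)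
    simp [hM]
  have hdv : minpoly ℂ M ∣ X - C α := by
    rw [← hsq.dvd_pow_iff_dvd hd.ne', ← hch]
    exact Matrix.minpoly_dvd_charpoly M
  have := (minpoly.dvd_iff).1 hdv
  simpa [sub_eq_zero] using this

lemma aux_trace_lmul {ι : Type*} [Fintype ι] [DecidableEq ι] (d : ι → ℕ)
    (m : Π i, Matrix (Fin (d i)) (Fin (d i)) ℂ) :
    LinearMap.trace ℂ _ (LinearMap.mulLeft ℂ m) = ∑ i, (d i : ℂ) * (m i).trace := by
  rw [LinearMap.trace_eq_matrix_trace ℂ (Pi.basis fun i => Matrix.stdBasis ℂ (Fin (d i)) (Fin (d i)))]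
  rw [Matrix.trace, Fintype.sum_sigma]
  refine Finset.sum_congr rfl fun i _ => ?_
  rw [Fintype.sum_prod_type]
  simp only [Matrix.diag_apply, LinearMap.toMatrix_apply, Pi.basis_apply, Pi.basis_repr, LinearMap.mulLeft_apply, Pi.mul_apply, Pi.single_eq_same, Matrix.stdBasis_eq_single]
  simp [Matrix.stdBasis, Matrix.trace, Finset.mul_sum, Matrix.mul_single_apply_same]

lemma aux_trace_grp {G : Type*} [Group G] [Finite G] (x : G) (hx : x ≠ 1) :
    LinearMap.trace ℂ _ (LinearMap.mulLeft ℂ (MonoidAlgebra.of ℂ G x)) = 0 := by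
  classical
  have := Fintype.ofFinite G
  rw [LinearMap.trace_eq_matrix_trace ℂ (MonoidAlgebra.basis G ℂ)]
  refine Finset.sum_eq_zero fun g _ => ?_
  rw [Matrix.diag_apply, LinearMap.toMatrix_apply, MonoidAlgebra.basis_apply, LinearMap.mulLeft_apply, MonoidAlgebra.of_apply, MonoidAlgebra.single_mul_single]
  simp [MonoidAlgebra.basis, hx]

lemma aux_commute {G : Type*} [Group G] {d : ℕ}
    (φ : MonoidAlgebra ℂ G →ₐ[ℂ] Matrix (Fin d) (Fin d) ℂ) (hφ : Function.Surjective φ)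
    (T : Matrix (Fin d) (Fin d) ℂ) (hT : ∀ g, Commute T (φ (MonoidAlgebra.of ℂ G g))) :
    ∃ c : ℂ, T = algebraMap ℂ _ c := by
  have h1 : ∀ a, Commute T (φ a) := by
    intro a
    induction a using MonoidAlgebra.induction_on with
    | of g => exact hT g
    | add a b ha hb => rw [map_add]; exact ha.add_right hb
    | smul r a ha => rw [map_smul]; exact ha.smul_right r
  have h2 : T ∈ Set.center (Matrix (Fin d) (Fin d) ℂ) := by
    rw [Semigroup.mem_center_iff]
    intro b
    obtain ⟨a, rfl⟩ := hφ b
    exact (h1 a).symm.eq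
  rw [Matrix.center_eq_range] at h2
  obtain ⟨c, hc⟩ := h2
  exact ⟨c, by rw [← hc]; rfl⟩

lemma aux_omega {G : Type*} [Group G] [Finite G] {d : ℕ} (hd : 0 < d)
    (φ : MonoidAlgebra ℂ G →ₐ[ℂ] Matrix (Fin d) (Fin d) ℂ) (hφ : Function.Surjective φ) (x : G) :
    ∃ w : ℂ, IsIntegral ℤ w ∧
      (classSize x : ℂ) * (φ (MonoidAlgebra.of ℂ G x)).trace = d * w := by
  classical
  have := Fintype.ofFinite G
  have : Nonempty (Fin d) := ⟨⟨0, hd⟩⟩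
  let R : G →* Matrix (Fin d) (Fin d) ℂ := (φ : MonoidAlgebra ℂ G →* _).comp (MonoidAlgebra.of ℂ G)
  let C : Finset G := Finset.univ.filter (fun y => IsConj x y)
  let S := ∑ g ∈ C, R g
  have hSint : IsIntegral ℤ S := by
    let f := MonoidAlgebra.lift ℤ (Matrix (Fin d) (Fin d) ℂ) G R
    have : S = f (∑ g ∈ C, MonoidAlgebra.of ℤ G g) := by
      simp [S, f, map_sum]
    rw [this]
    have : Module.Finite ℤ (MonoidAlgebra ℤ G) := Module.Finite.of_basis (MonoidAlgebra.basis G ℤ)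
    exact (IsIntegral.of_finite ℤ _).map f
  have hScomm : ∀ g, Commute S (R g) := by
    intro g
    have : R g * S = S * R g := by
      simp only [S, Finset.mul_sum, Finset.sum_mul]
      refine Finset.sum_bij (fun y _ => g * y * g⁻¹) ?_ ?_ ?_ ?_
      · intro y hy
        simp only [C, Finset.mem_filter, Finset.mem_univ, true_and] at hy ⊢
        exact hy.trans (isConj_iff.2 ⟨g, rfl⟩)
      · intro a _ b _ h
        simpa using h
      · intro b hb
        refine ⟨g⁻¹ * b * g, ?_, by group⟩
        simp only [C, Finset.mem_filter, Finset.mem_univ, true_and] at hb ⊢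
        exact hb.trans (isConj_iff.2 ⟨g⁻¹, by simp⟩)
      · intro a _
        rw [← map_mul, ← map_mul]; congr 1; group
    exact this.symm
  obtain ⟨w, hw⟩ := aux_commute φ hφ S hScomm
  refine ⟨w, ?_, ?_⟩
  · rw [hw] at hSint
    exact (isIntegral_algebraMap_iff (FaithfulSMul.algebraMap_injective ℂ (Matrix (Fin d) (Fin d) ℂ))).1 hSint
  · have h1 : S.trace = d * w := by
      rw [hw, Matrix.algebraMap_eq_diagonal, Matrix.trace_diagonal]; simp
    have h2 : ∀ g ∈ C, (R g).trace = (R x).trace := by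
      intro g hg
      simp only [C, Finset.mem_filter, Finset.mem_univ, true_and] at hg
      obtain ⟨c, rfl⟩ := isConj_iff.1 hg
      rw [map_mul, Matrix.trace_mul_comm, ← map_mul]; congr 2; group
    have h3 : C.card = classSize x := by
      simp [C, classSize, Fintype.card_subtype]
    rw [← h1, ← h3, Matrix.trace_sum, Finset.sum_congr rfl h2]
    simp [R]

lemma aux_central {G : Type*} [Group G] (x : G) (h : ∀ g, g * x = x * g) : classSize x = 1 := by
  rw [classSize, Nat.card_eq_one_iff_unique]
  refine ⟨⟨?_⟩, ⟨⟨x, IsConj.refl x⟩⟩⟩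
  have key : ∀ y, IsConj x y → y = x := by
    intro y hy
    obtain ⟨c, rfl⟩ := isConj_iff.1 hy
    rw [h]; group
  rintro ⟨a, ha⟩ ⟨b, hb⟩
  exact Subtype.ext ((key a ha).trans (key b hb).symm)

lemma aux_triv {G : Type*} [Group G] {d : ℕ}
    (φ : MonoidAlgebra ℂ G →ₐ[ℂ] Matrix (Fin d) (Fin d) ℂ)
    (h : ∀ g, φ (MonoidAlgebra.of ℂ G g) = 1) (a : MonoidAlgebra ℂ G) :
    φ a = algebraMap ℂ _ (MonoidAlgebra.lift ℂ ℂ G 1 a) := by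
  induction a using MonoidAlgebra.induction_on with
  | of g => rw [h, MonoidAlgebra.lift_of]; simp
  | add a b ha hb => rw [map_add, map_add, map_add, ha, hb]
  | smul r a ha => rw [map_smul, map_smul, ha, Algebra.smul_def, smul_eq_mul, map_mul]

lemma aux_not_int (p : ℕ) (hp : p.Prime) (w : ℂ) (hw : IsIntegral ℤ w) : 1 + p * w ≠ 0 := by
  intro h
  have hp0 : (p : ℂ) ≠ 0 := by exact_mod_cast hp.ne_zero
  have h1 : w = algebraMap ℚ ℂ (-1 / p) := by
    simp; field_simp; linear_combination h
  rw [h1, isIntegral_algebraMap_iff (algebraMap ℚ ℂ).injective, IsIntegrallyClosed.isIntegral_iff] at hw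
  obtain ⟨y, hy⟩ := hw
  have hp0' : (p : ℚ) ≠ 0 := by exact_mod_cast hp.ne_zero
  have h2 : (p : ℤ) * y = -1 := by
    have : (p : ℚ) * y = -1 := by
      rw [show (y : ℚ) = -1 / p from hy]; field_simp
    exact_mod_cast this
  have h3 : (p : ℤ) ∣ 1 := ⟨-y, by linarith⟩
  exact hp.one_lt.ne' (by exact_mod_cast Int.eq_one_of_dvd_one (by positivity) h3)

theorem stmt_2 {G : Type*} [Group G] [Finite G] (x : G) (p k : ℕ)
    (hp : p.Prime) (hk : 1 ≤ k) (h : classSize x = p ^ k) :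
    ¬ IsSimpleGroup G := by
  classical
  intro hG
  have := Fintype.ofFinite G
  have hpk : 1 < p ^ k := Nat.one_lt_pow (by omega) hp.one_lt
  have hncen : ¬ ∀ g, g * x = x * g := fun hc => by
    have := aux_central x hc; omega
  have hx1 : x ≠ 1 := by rintro rfl; exact hncen (by simp)
  have : NeZero (Nat.card G : ℂ) := ⟨by exact_mod_cast Nat.card_pos.ne'⟩
  have : FiniteDimensional ℂ (MonoidAlgebra ℂ G) := Module.Finite.of_basis (MonoidAlgebra.basis G ℂ)
  obtain ⟨N, d, hd, ⟨e⟩⟩ :=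
    IsSemisimpleRing.exists_algEquiv_pi_matrix_of_isAlgClosed ℂ (MonoidAlgebra ℂ G)
  have hd0 : ∀ i, 0 < d i := fun i => Nat.pos_of_ne_zero (hd i).out
  let φ : ∀ i, MonoidAlgebra ℂ G →ₐ[ℂ] Matrix (Fin (d i)) (Fin (d i)) ℂ := fun i =>
    (Pi.evalAlgHom ℂ (fun i => Matrix (Fin (d i)) (Fin (d i)) ℂ) i).comp e.toAlgHom
  have hφe : ∀ i a, φ i a = e a i := fun i a => rfl
  have hsurj : ∀ i, Function.Surjective (φ i) := fun i b =>
    ⟨e.symm (Pi.single i b), by simp [hφe]⟩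
  have htr : ∑ i, (d i : ℂ) * (φ i (MonoidAlgebra.of ℂ G x)).trace = 0 := by
    rw [← aux_trace_grp x hx1]
    have := aux_trace_lmul d (e (MonoidAlgebra.of ℂ G x))
    simp only [hφe]
    rw [← this, ← LinearMap.trace_conj' _ e.toLinearEquiv]
    congr 1
    refine LinearMap.ext fun m => ?_
    simp [LinearEquiv.conj_apply]
  -- trivial component exists
  obtain ⟨i₀, hi₀⟩ : ∃ i, ∀ g, φ i (MonoidAlgebra.of ℂ G g) = 1 := by
    let u : MonoidAlgebra ℂ G := ∑ g, MonoidAlgebra.of ℂ G g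
    have hgu : ∀ g, MonoidAlgebra.of ℂ G g * u = u := by
      intro g
      simp only [u, Finset.mul_sum, ← map_mul]
      exact Fintype.sum_equiv (Equiv.mulLeft g) _ _ (fun _ => rfl)
    have hug : ∀ g, u * MonoidAlgebra.of ℂ G g = u := by
      intro g
      simp only [u, Finset.sum_mul, ← map_mul]
      exact Fintype.sum_equiv (Equiv.mulRight g) _ _ (fun _ => rfl)
    have hu : u ≠ 0 := by
      intro h0
      have := congrArg (MonoidAlgebra.lift ℂ ℂ G 1) h0
      simp [u, map_sum, -MonoidAlgebra.of_apply, MonoidAlgebra.lift_of] at this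
    have heu : e u ≠ 0 := by simpa using hu
    obtain ⟨i, hi⟩ := Function.ne_iff.1 heu
    refine ⟨i, fun g => ?_⟩
    obtain ⟨c, hc⟩ := aux_commute (φ i) (hsurj i) (φ i u) (fun g => by
      rw [Commute, SemiconjBy, ← map_mul, ← map_mul, hgu, hug])
    have hc0 : c ≠ 0 := by
      rintro rfl
      exact hi (by rw [← hφe, hc]; simp)
    have h1 : φ i (MonoidAlgebra.of ℂ G g) * φ i u = φ i u := by rw [← map_mul, hgu]
    rw [hc, ← Algebra.commutes, ← Algebra.smul_def, Algebra.algebraMap_eq_smul_one] at h1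
    exact smul_right_injective _ hc0 h1
  have huniq : ∀ i, (∀ g, φ i (MonoidAlgebra.of ℂ G g) = 1) → i = i₀ := by
    intro i hi
    by_contra hne
    let a := e.symm (Pi.single i 1)
    have h1 := aux_triv _ hi a
    have h2 := aux_triv _ hi₀ a
    rw [hφe, AlgEquiv.apply_symm_apply] at h1 h2
    rw [Pi.single_eq_same] at h1
    rw [Pi.single_eq_of_ne (Ne.symm hne)] at h2
    have : Nonempty (Fin (d i₀)) := ⟨⟨0, hd0 _⟩⟩
    have : Nonempty (Fin (d i)) := ⟨⟨0, hd0 _⟩⟩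
    have h3 := (map_eq_zero_iff _ (FaithfulSMul.algebraMap_injective ℂ (Matrix (Fin (d i₀)) (Fin (d i₀)) ℂ))).1 h2.symm
    rw [h3, map_zero] at h1
    exact one_ne_zero h1
  have hdi₀ : d i₀ = 1 := by
    have hs : Function.Surjective (Algebra.linearMap ℂ (Matrix (Fin (d i₀)) (Fin (d i₀)) ℂ)) := by
      intro b
      obtain ⟨a, rfl⟩ := hsurj i₀ b
      exact ⟨_, (aux_triv _ hi₀ a).symm⟩
    have := LinearMap.finrank_le_finrank_of_surjective hs
    simp [Module.finrank_matrix] at this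
    have := hd0 i₀
    nlinarith
  -- matrix powers
  have hn : 0 < Nat.card G := Nat.card_pos
  have hpow : ∀ i g, φ i (MonoidAlgebra.of ℂ G g) ^ Nat.card G = 1 := fun i g => by
    rw [← map_pow, ← map_pow, pow_card_eq_one', map_one, map_one]
  have hχint : ∀ i g, IsIntegral ℤ (φ i (MonoidAlgebra.of ℂ G g)).trace := fun i g =>
    aux_trace_int _ _ hn (hpow i g)
  obtain ⟨i, hine, hpd, hχ0⟩ : ∃ i, i ≠ i₀ ∧ ¬ p ∣ d i ∧ (φ i (MonoidAlgebra.of ℂ G x)).trace ≠ 0 := by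
    by_contra! hcon
    have hw : ∀ i, ∃ w : ℂ, IsIntegral ℤ w ∧ (i ≠ i₀ →
        (d i : ℂ) * (φ i (MonoidAlgebra.of ℂ G x)).trace = p * w) := by
      intro i
      by_cases hi : i = i₀
      · exact ⟨0, isIntegral_zero, fun h => absurd hi h⟩
      by_cases hdv : p ∣ d i
      · obtain ⟨c, hc⟩ := hdv
        refine ⟨c * (φ i (MonoidAlgebra.of ℂ G x)).trace, ?_, fun _ => ?_⟩
        · exact (isIntegral_natCast (R := ℤ) c).mul (hχint i x)
        · have hcC : (d i : ℂ) = p * c := by exact_mod_cast hc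
          rw [hcC]; ring
      · exact ⟨0, isIntegral_zero, fun _ => by rw [hcon i hi hdv]; simp⟩
    choose w hwi hw using hw
    rw [← Finset.add_sum_erase _ _ (Finset.mem_univ i₀)] at htr
    rw [Finset.sum_congr rfl (fun i hi => hw i (Finset.ne_of_mem_erase hi)), ← Finset.mul_sum,
      hi₀, Matrix.trace_one, Fintype.card_fin, hdi₀] at htr
    refine aux_not_int p hp (∑ i ∈ Finset.univ.erase i₀, w i) ?_ (by simpa using htr)
    exact IsIntegral.sum _ fun i _ => hwi i
  set χ := (φ i (MonoidAlgebra.of ℂ G x)).trace with hχ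
  have hdC : (d i : ℂ) ≠ 0 := by exact_mod_cast (hd0 i).ne'
  have hint : IsIntegral ℤ (χ / d i) := by
    obtain ⟨w, hwi, hw⟩ := aux_omega (hd0 i) (φ i) (hsurj i) x
    rw [h, ← hχ] at hw
    have hcop : Nat.Coprime (p ^ k) (d i) := Nat.Coprime.pow_left _ ((Nat.Prime.coprime_iff_not_dvd hp).2 hpd)
    obtain ⟨a, b, hab⟩ := (Nat.isCoprime_iff_coprime.2 hcop)
    have habC : (a : ℂ) * (p ^ k : ℕ) + b * (d i) = 1 := by exact_mod_cast congrArg (Int.cast : ℤ → ℂ) hab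
    have : χ / d i = a * w + b * χ := by
      field_simp
      linear_combination (-χ) * habC + a * hw
    rw [this]
    exact ((isIntegral_intCast (R := ℤ) a).mul hwi).add ((isIntegral_intCast (R := ℤ) b).mul (hχint i x))
  have hsc := aux_scalar (hd0 i) _ _ hn (hpow i x) hint hχ0
  let R : G →* Matrix (Fin (d i)) (Fin (d i)) ℂ :=
    (φ i : MonoidAlgebra ℂ G →* _).comp (MonoidAlgebra.of ℂ G)
  have hRx : R x = algebraMap ℂ _ (χ / d i) := hsc
  rcases hG.eq_bot_or_eq_top_of_normal R.ker inferInstance with hb | ht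
  · have hinj : Function.Injective R := (MonoidHom.ker_eq_bot_iff R).1 hb
    refine hncen fun g => hinj ?_
    rw [map_mul, map_mul, hRx]
    exact (Algebra.commutes _ _).symm
  · refine hine (huniq i fun g => ?_)
    have : g ∈ R.ker := ht ▸ Subgroup.mem_top g
    exact this
end

section
/- The same-size conjugacy class set of PSL(2,7) is {1, 21, 42, 48, 56}. -/
open scoped MatrixGroups

instance : Fact (Nat.Prime 7) := ⟨by norm_num⟩

open Matrix

abbrev Q4 := ZMod 7 × ZMod 7 × ZMod 7 × ZMod 7

def mk4 (v : Q4) (h : v.1 * v.2.2.2 - v.2.1 * v.2.2.1 = 1) : SL(2, ZMod 7) :=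
  ⟨!![v.1, v.2.1; v.2.2.1, v.2.2.2], by rw [Matrix.det_fin_two_of]; exact h⟩

def toQ (A : SL(2, ZMod 7)) : Q4 := (A.1 0 0, A.1 0 1, A.1 1 0, A.1 1 1)

lemma toQ_det (A : SL(2, ZMod 7)) :
    (toQ A).1 * (toQ A).2.2.2 - (toQ A).2.1 * (toQ A).2.2.1 = 1 := by
  have := A.2
  rw [Matrix.det_fin_two] at this
  exact this

def eqv : SL(2, ZMod 7) ≃ {v : Q4 // v.1 * v.2.2.2 - v.2.1 * v.2.2.1 = 1} where
  toFun A := ⟨toQ A, toQ_det A⟩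
  invFun v := mk4 v.1 v.2
  left_inv A := by
    apply Subtype.ext
    exact (Matrix.eta_fin_two A.1).symm
  right_inv v := by
    apply Subtype.ext
    simp [toQ, mk4]

abbrev dq (v : Q4) : Prop :=
  (v.1.val * v.2.2.2.val + 6 * (v.2.1.val * v.2.2.1.val)) % 7 = 1

lemma dq_iff (v : Q4) : v.1 * v.2.2.2 - v.2.1 * v.2.2.1 = 1 ↔ dq v := by
  have h := ZMod.natCast_eq_natCast_iff'
    (v.1.val * v.2.2.2.val + 6 * (v.2.1.val * v.2.2.1.val)) 1 7
  have h6 : (6 : ZMod 7) = -1 := by decide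
  push_cast at h
  simp only [ZMod.natCast_zmod_val, h6] at h
  rw [neg_one_mul, ← sub_eq_add_neg] at h
  exact h

lemma card_count (P : SL(2, ZMod 7) → Prop) (R : Q4 → Prop) [DecidablePred R]
    (h : ∀ A, P A ↔ R (toQ A)) :
    Nat.card {A // P A} = (Finset.univ.filter
      (fun v : Q4 => dq v ∧ R v)).card := by
  simp only [← dq_iff]
  rw [← Fintype.card_subtype, ← Nat.card_eq_fintype_card]
  refine Nat.card_congr ?_
  refine (Equiv.subtypeEquiv (q := fun v => R v.1) eqv h).trans ?_
  exact Equiv.subtypeSubtypeEquivSubtypeInter _ _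

/-- product `C * M` on tuples -/
def mulQ (c m : Q4) : Q4 :=
  (c.1 * m.1 + c.2.1 * m.2.2.1, c.1 * m.2.1 + c.2.1 * m.2.2.2,
   c.2.2.1 * m.1 + c.2.2.2 * m.2.2.1, c.2.2.1 * m.2.1 + c.2.2.2 * m.2.2.2)

lemma toQ_mul (A B : SL(2, ZMod 7)) : toQ (A * B) = mulQ (toQ A) (toQ B) := by
  simp [toQ, mulQ, Matrix.mul_apply, Fin.sum_univ_two]

lemma toQ_inj {A B : SL(2, ZMod 7)} : toQ A = toQ B ↔ A = B := by
  constructor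
  · intro h
    exact eqv.injective (Subtype.ext h)
  · rintro rfl; rfl

lemma toQ_neg (A : SL(2, ZMod 7)) : toQ (-A) = -toQ A := by
  simp [toQ]

lemma center_iff (A : SL(2, ZMod 7)) :
    A ∈ Subgroup.center SL(2, ZMod 7) ↔ A = 1 ∨ A = -1 := by
  constructor
  · intro h
    obtain ⟨r, hr, hA⟩ := Matrix.SpecialLinearGroup.mem_center_iff.1 h
    have h2 : r = 1 ∨ r = -1 := by
      rw [Fintype.card_fin] at hr
      have key : ∀ r : ZMod 7, r ^ 2 = 1 → r = 1 ∨ r = -1 := by decide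
      exact key r hr
    rcases h2 with rfl | rfl
    · left; apply Subtype.ext; rw [← hA]; simp
    · right; apply Subtype.ext; rw [← hA, map_neg, map_one]; rfl
  · rintro (rfl | rfl)
    · exact one_mem _
    · rw [Subgroup.mem_center_iff]; intro g; simp

abbrev pr (A : SL(2, ZMod 7)) : PSL(2, ZMod 7) :=
  QuotientGroup.mk' (Subgroup.center SL(2, ZMod 7)) A

lemma pr_eq (A B : SL(2, ZMod 7)) : pr A = pr B ↔ A = B ∨ A = -B := by
  show ((A : PSL(2, ZMod 7)) = B) ↔ _
  rw [eq_comm, QuotientGroup.eq, center_iff, inv_mul_eq_one, inv_mul_eq_iff_eq_mul]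
  simp [eq_comm]

lemma pr_comm (C M N : SL(2, ZMod 7)) : pr C * pr M = pr N * pr C ↔
    (mulQ (toQ C) (toQ M) = mulQ (toQ N) (toQ C) ∨
      mulQ (toQ C) (toQ M) = -mulQ (toQ N) (toQ C)) := by
  rw [← map_mul, ← map_mul, pr_eq, ← toQ_mul, ← toQ_mul, ← toQ_neg, toQ_inj, toQ_inj]

lemma card_SL : Nat.card SL(2, ZMod 7) = 336 := by
  rw [← Nat.card_congr (Equiv.subtypeUnivEquiv (p := fun _ : SL(2, ZMod 7) => True)
    (fun _ => trivial)), card_count _ (fun _ => True) (fun _ => Iff.rfl)]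
  decide +kernel

lemma card_PSL : Nat.card PSL(2, ZMod 7) = 168 := by
  have h := (Subgroup.center SL(2, ZMod 7)).index_mul_card
  have h2 : Nat.card (Subgroup.center SL(2, ZMod 7)) = 2 := by
    have := card_count (fun A => A ∈ Subgroup.center SL(2, ZMod 7))
      (fun v => v = toQ 1 ∨ v = - toQ 1)
      (fun A => by rw [center_iff, ← toQ_neg, toQ_inj, toQ_inj])
    refine this.trans ?_
    decide +kernel
  rw [h2, card_SL] at h
  change (Subgroup.center SL(2, ZMod 7)).index = _
  omega

lemma classSize_index {G : Type*} [Group G] (x : G) :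
    classSize x = (Subgroup.centralizer {x}).index := by
  have h := MulAction.index_stabilizer (ConjAct G) x
  have h2 : (MulAction.stabilizer (ConjAct G) x).index = (Subgroup.centralizer {x}).index := by
    rw [Subgroup.centralizer_eq_comap_stabilizer]
    exact (Subgroup.index_comap_of_surjective _ ConjAct.toConjAct.surjective).symm
  rw [← h2, h, classSize, ← Nat.card_coe_set_eq]
  refine Nat.card_congr (Equiv.subtypeEquivRight fun y => ?_)
  rw [ConjAct.mem_orbit_conjAct, isConj_comm]

def cnt (m : Q4) : ℕ := (Finset.univ.filter
      (fun v : Q4 => dq v ∧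
        (mulQ v m = mulQ m v ∨ mulQ v m = - mulQ m v))).card

lemma classSize_pr (M : SL(2, ZMod 7)) : classSize (pr M) * cnt (toQ M) = 336 := by
  have hs : Function.Surjective (QuotientGroup.mk' (Subgroup.center SL(2, ZMod 7))) :=
    QuotientGroup.mk'_surjective _
  rw [classSize_index, ← Subgroup.index_comap_of_surjective _ hs, ← card_SL,
    ← Subgroup.index_mul_card ((Subgroup.centralizer {pr M}).comap
      (QuotientGroup.mk' (Subgroup.center SL(2, ZMod 7))))]
  congr 1
  refine (card_count _ _ fun A => ?_).symm
  rw [← pr_comm, Subgroup.mem_comap, Subgroup.mem_centralizer_singleton_iff]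

def r1 := mk4 (1, 0, 0, 1) (by decide)
def r2 := mk4 (0, -1, 1, 0) (by decide)
def r3 := mk4 (0, -1, 1, 1) (by decide)
def r4 := mk4 (0, -1, 1, 3) (by decide)
def r5 := mk4 (1, 1, 0, 1) (by decide)
def r6 := mk4 (1, 3, 0, 1) (by decide)

lemma cs_aux (M : SL(2, ZMod 7)) (k n : ℕ) (h : cnt (toQ M) = k) (hk : 0 < k)
    (hn : n * k = 336) : classSize (pr M) = n := by
  have := classSize_pr M
  rw [h, ← hn] at this
  exact Nat.eq_of_mul_eq_mul_right hk this

lemma c1 : classSize (pr r1) = 1 := cs_aux _ 336 1 (by decide +kernel) (by simp) (by simp)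
lemma c2 : classSize (pr r2) = 21 := cs_aux _ 16 21 (by decide +kernel) (by simp) (by simp)
lemma c3 : classSize (pr r3) = 56 := cs_aux _ 6 56 (by decide +kernel) (by simp) (by simp)
lemma c4 : classSize (pr r4) = 42 := cs_aux _ 8 42 (by decide +kernel) (by simp) (by simp)
lemma c5 : classSize (pr r5) = 24 := cs_aux _ 14 24 (by decide +kernel) (by simp) (by simp)
lemma c6 : classSize (pr r6) = 24 := cs_aux _ 14 24 (by decide +kernel) (by simp) (by simp)

lemma not56 : ¬ IsConj (pr r5) (pr r6) := by
  rw [isConj_iff]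
  rintro ⟨c, hc⟩
  obtain ⟨C, rfl⟩ := QuotientGroup.mk'_surjective _ c
  have h := (pr_comm C r5 r6).1 (mul_inv_eq_iff_eq_mul.1 hc)
  have key : ∀ v : Q4, dq v →
      ¬ (mulQ v (toQ r5) = mulQ (toQ r6) v ∨ mulQ v (toQ r5) = - mulQ (toQ r6) v) := by
    decide +kernel
  exact key _ ((dq_iff _).1 (toQ_det C)) h

lemma classSize_conj {G : Type*} [Group G] {x y : G} (h : IsConj x y) :
    classSize x = classSize y :=
  Nat.card_congr (Equiv.subtypeEquivRight fun _ => ⟨h.symm.trans, h.trans⟩)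

def K {G : Type*} [Group G] (x : G) : Set G := {y | IsConj x y}

lemma K_card {G : Type*} [Group G] (x : G) : (K x).ncard = classSize x :=
  (Nat.card_coe_set_eq _).symm

lemma K_disj {G : Type*} [Group G] {x y : G} (h : ¬ IsConj x y) : Disjoint (K x) (K y) :=
  Set.disjoint_left.2 fun _ hx hy => h (IsConj.trans hx (IsConj.symm hy))

lemma K_disj' {G : Type*} [Group G] {x y : G} (h : classSize x ≠ classSize y) :
    Disjoint (K x) (K y) := K_disj fun hc => h (classSize_conj hc)

instance finPSL : Finite PSL(2, ZMod 7) := Nat.finite_of_card_ne_zero (by rw [card_PSL]; simp)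

lemma card56 : (K (pr r5) ∪ K (pr r6)).ncard = 48 := by
  rw [Set.ncard_union_eq (K_disj not56), K_card, K_card, c5, c6]

lemma cover : K (pr r1) ∪ (K (pr r2) ∪ (K (pr r3) ∪ (K (pr r4) ∪ (K (pr r5) ∪ K (pr r6)))))
    = Set.univ := by
  rw [Set.eq_univ_iff_ncard, card_PSL, Set.ncard_union_eq, Set.ncard_union_eq,
    Set.ncard_union_eq, Set.ncard_union_eq, card56, K_card, K_card, K_card, K_card, c1, c2, c3, c4]
  all_goals
    simp only [Set.disjoint_union_right]
    (try refine ⟨?_, ?_⟩) <;> (try refine ⟨?_, ?_⟩) <;> (try refine ⟨?_, ?_⟩) <;>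
      (try refine ⟨?_, ?_⟩) <;> exact K_disj' (by simp only [c1, c2, c3, c4, c5, c6]; decide)

lemma cases6 (x : PSL(2, ZMod 7)) : IsConj (pr r1) x ∨ IsConj (pr r2) x ∨ IsConj (pr r3) x ∨
    IsConj (pr r4) x ∨ IsConj (pr r5) x ∨ IsConj (pr r6) x := by
  have : x ∈ Set.univ := Set.mem_univ x
  rw [← cover] at this
  exact this

lemma cs6 (x : PSL(2, ZMod 7)) : (classSize x = 1 ∧ IsConj (pr r1) x) ∨
    (classSize x = 21 ∧ IsConj (pr r2) x) ∨ (classSize x = 56 ∧ IsConj (pr r3) x) ∨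
    (classSize x = 42 ∧ IsConj (pr r4) x) ∨
    (classSize x = 24 ∧ (IsConj (pr r5) x ∨ IsConj (pr r6) x)) := by
  rcases cases6 x with h | h | h | h | h | h <;> have e := classSize_conj h
  · rw [c1] at e; exact Or.inl ⟨e.symm, h⟩
  · rw [c2] at e; exact Or.inr (Or.inl ⟨e.symm, h⟩)
  · rw [c3] at e; exact Or.inr (Or.inr (Or.inl ⟨e.symm, h⟩))
  · rw [c4] at e; exact Or.inr (Or.inr (Or.inr (Or.inl ⟨e.symm, h⟩)))
  · rw [c5] at e; exact Or.inr (Or.inr (Or.inr (Or.inr ⟨e.symm, Or.inl h⟩)))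
  · rw [c6] at e; exact Or.inr (Or.inr (Or.inr (Or.inr ⟨e.symm, Or.inr h⟩)))

lemma u_aux (r : SL(2, ZMod 7)) (n : ℕ) (hr : classSize (pr r) = n)
    (h : ∀ x, classSize x = n → IsConj (pr r) x) : sameSizeCount PSL(2, ZMod 7) n = n := by
  conv_rhs => rw [← hr]
  refine Nat.card_congr (Equiv.subtypeEquivRight fun x => ⟨h x, fun hx => ?_⟩)
  rw [← classSize_conj hx, hr]

lemma u1 : sameSizeCount PSL(2, ZMod 7) 1 = 1 := u_aux r1 1 c1 fun x hx => by
  have := cs6 x; rw [hx] at this; simpa using this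
lemma u2 : sameSizeCount PSL(2, ZMod 7) 21 = 21 := u_aux r2 21 c2 fun x hx => by
  have := cs6 x; rw [hx] at this; simpa using this
lemma u3 : sameSizeCount PSL(2, ZMod 7) 56 = 56 := u_aux r3 56 c3 fun x hx => by
  have := cs6 x; rw [hx] at this; simpa using this
lemma u4 : sameSizeCount PSL(2, ZMod 7) 42 = 42 := u_aux r4 42 c4 fun x hx => by
  have := cs6 x; rw [hx] at this; simpa using this
lemma u5 : sameSizeCount PSL(2, ZMod 7) 24 = 48 := by
  rw [← card56, ← Nat.card_coe_set_eq]
  refine Nat.card_congr (Equiv.subtypeEquivRight fun x => ⟨fun hx => ?_, ?_⟩)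
  · have := cs6 x; rw [hx] at this
    rcases this with h | h | h | h | h
    all_goals first | exact h.2 | exact absurd h.1 (by decide)
  · rintro (h | h)
    · rw [← classSize_conj h, c5]
    · rw [← classSize_conj h, c6]

theorem stmt_11 : sameSizeSet (PSL(2, ZMod 7)) = {1, 21, 42, 48, 56} := by
  ext m
  simp only [sameSizeSet, Set.mem_ofPred_eq, Set.mem_insert_iff, Set.mem_singleton_iff]
  constructor
  · rintro ⟨x, rfl⟩
    rcases cs6 x with h | h | h | h | h <;> rw [h.1]
    · simp [u1]
    · simp [u2]
    · simp [u3]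
    · simp [u4]
    · simp [u5]
  · rintro (rfl | rfl | rfl | rfl | rfl)
    · exact ⟨pr r1, by rw [c1, u1]⟩
    · exact ⟨pr r2, by rw [c2, u2]⟩
    · exact ⟨pr r4, by rw [c4, u4]⟩
    · exact ⟨pr r5, by rw [c5, u5]⟩
    · exact ⟨pr r3, by rw [c3, u3]⟩
end

section
/- The same-size conjugacy class set of PSL(2,17) is {1, 153, 288, 918, 1088}. -/
open scoped MatrixGroups

instance : Fact (Nat.Prime 17) := ⟨by norm_num⟩
namespace PSL17

abbrev F := ZMod 17
abbrev S := SL(2, ZMod 17)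

/-- class size as a function of the trace for non-central elements -/
def s (t : F) : ℕ :=
  if t = 0 then 153 else if t = 2 ∨ t = -2 then 144 else
    if t ^ 2 = 1 ∨ t ^ 2 = 16 ∨ t ^ 2 = 9 ∨ t ^ 2 = 15 then 272 else 306

/-- number of solutions of the norm equation -/
def N (t : F) : ℕ := (Finset.univ.filter fun p : F × F => p.1 ^ 2 + t * p.1 * p.2 + p.2 ^ 2 = 1).card

theorem N_zero : N 0 = 16 := by decide +kernel
theorem s_mul_N : ∀ t : F, t ≠ 0 → s t * N t = 4896 := by decide +kernel

def inner (b : Bool) (m : F) : ℕ :=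
  (Finset.univ.filter fun p : F × F => p.1 * p.2 = m ∧ ¬ (b ∧ p.1 = 0 ∧ p.2 = 0)).card

theorem inner_eq : ∀ b m, inner b m = if m = 0 then (if b then 32 else 33) else 16 := by
  decide +kernel

theorem eq_iff (A B : S) : A = B ↔ A 0 0 = B 0 0 ∧ A 0 1 = B 0 1 ∧ A 1 0 = B 1 0 ∧ A 1 1 = B 1 1 := by
  rw [Matrix.SpecialLinearGroup.ext_iff]
  simp [Fin.forall_fin_two, and_assoc]

theorem det_eq (A : S) : A 0 0 * A 1 1 - A 0 1 * A 1 0 = 1 := by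
  rw [← Matrix.det_fin_two, A.2]

def mk (a b c d : F) (h : a * d - b * c = 1) : S := ⟨!![a, b; c, d], by simpa [Matrix.det_fin_two] using h⟩

@[simp] theorem mk00 (a b c d : F) (h) : (mk a b c d h) 0 0 = a := rfl
@[simp] theorem mk01 (a b c d : F) (h) : (mk a b c d h) 0 1 = b := rfl
@[simp] theorem mk10 (a b c d : F) (h) : (mk a b c d h) 1 0 = c := rfl
@[simp] theorem mk11 (a b c d : F) (h) : (mk a b c d h) 1 1 = d := rfl

theorem central_iff (A : S) : (A = 1 ∨ A = -1) ↔ (A 0 0 = A 1 1 ∧ A 0 1 = 0 ∧ A 1 0 = 0) := by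
  have h := det_eq A
  constructor
  · rintro (rfl | rfl) <;> simp
  · rintro ⟨h1, h2, h3⟩
    rw [h1, h2, h3] at h
    have : (A 1 1 - 1) * (A 1 1 + 1) = 0 := by linear_combination h
    rcases mul_eq_zero.1 this with h4 | h4
    · left; rw [eq_iff]; simp [h1, h2, h3]; linear_combination h4
    · right; rw [eq_iff]; simp [h1, h2, h3]; linear_combination h4

theorem mem_center (A : S) : A ∈ Subgroup.center S ↔ (A = 1 ∨ A = -1) := by
  constructor
  · intro h
    rw [Subgroup.mem_center_iff] at h
    have h1 := h (mk 1 1 0 1 (by simp))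
    have h2 := h (mk 1 0 1 1 (by simp))
    rw [central_iff]
    rw [eq_iff] at h1 h2
    simp [Matrix.mul_apply, Fin.sum_univ_two] at h1 h2
    grind
  · rintro (rfl | rfl)
    · exact one_mem _
    · rw [Subgroup.mem_center_iff]; intro g; simp

theorem neg_one_ne : (1 : S) ≠ -1 := by
  intro h
  rw [eq_iff] at h
  have := h.1
  simp at this
  exact absurd this (by decide)

theorem card_center : Nat.card (Subgroup.center S) = 2 := by
  have : ((Subgroup.center S : Subgroup S) : Set S) = {1, -1} := by
    ext A; simp [mem_center]
  rw [← SetLike.coe_sort_coe, this, Nat.card_coe_set_eq, Set.ncard_pair neg_one_ne]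

theorem card_lift (p : PSL(2, ZMod 17) → Prop) :
    2 * Nat.card {x // p x} = Nat.card {A : S // p (QuotientGroup.mk A)} := by
  have := Nat.card_congr (QuotientGroup.preimageMkEquivSubgroupProdSet (Subgroup.center S) {x | p x})
  rw [Nat.card_prod, card_center] at this
  exact this.symm

def eqv : S ≃ {p : (F × F) × (F × F) // p.1.1 * p.1.2 - p.2.1 * p.2.2 = 1} where
  toFun A := ⟨((A 0 0, A 1 1), (A 0 1, A 1 0)), det_eq A⟩
  invFun p := mk p.1.1.1 p.1.2.1 p.1.2.2 p.1.1.2 p.2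
  left_inv A := by rw [eq_iff]; simp [mk]
  right_inv p := by simp [mk]

theorem count (Q : S → Prop) (q : F → Prop) [DecidablePred q] (b : Bool)
    (h : ∀ A, Q A ↔ q (A 0 0 + A 1 1) ∧ ¬ (b ∧ (A 0 0 = A 1 1 ∧ A 0 1 = 0 ∧ A 1 0 = 0))) :
    Nat.card {A // Q A} = ∑ a : F, ∑ d : F, if q (a + d) then
      (if a * d = 1 then (if b = true ∧ a = d then 32 else 33) else 16) else 0 := by
  classical
  let R : (F × F) × (F × F) → Prop := fun p => p.1.1 * p.1.2 - p.2.1 * p.2.2 = 1 ∧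
    q (p.1.1 + p.1.2) ∧ ¬ (b ∧ (p.1.1 = p.1.2 ∧ p.2.1 = 0 ∧ p.2.2 = 0))
  have e : {A // Q A} ≃ {p // R p} :=
    (eqv.subtypeEquiv (q := fun p => q (p.1.1.1 + p.1.1.2) ∧
      ¬ (b ∧ (p.1.1.1 = p.1.1.2 ∧ p.1.2.1 = 0 ∧ p.1.2.2 = 0))) (fun A => h A)).trans
      (Equiv.subtypeSubtypeEquivSubtypeInter (fun p : (F × F) × (F × F) => p.1.1 * p.1.2 - p.2.1 * p.2.2 = 1)
        (fun p => q (p.1.1 + p.1.2) ∧ ¬ (b ∧ (p.1.1 = p.1.2 ∧ p.2.1 = 0 ∧ p.2.2 = 0))))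
  rw [Nat.card_congr e, Nat.card_eq_fintype_card, Fintype.card_subtype, Finset.card_filter,
    Fintype.sum_prod_type, Fintype.sum_prod_type]
  refine Finset.sum_congr rfl fun a _ => Finset.sum_congr rfl fun d _ => ?_
  rw [← Finset.card_filter]
  by_cases hq : q (a + d)
  · have := inner_eq (b && decide (a = d)) (a * d - 1)
    rw [inner] at this
    simp only [hq, if_true]
    have hset : (Finset.univ.filter fun i : F × F => R ((a, d), i)) = Finset.univ.filter fun p : F × F =>
        p.1 * p.2 = a * d - 1 ∧ ¬ ((b && decide (a = d)) ∧ p.1 = 0 ∧ p.2 = 0) := by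
      ext p
      simp only [R, hq, Finset.mem_filter, Finset.mem_univ, true_and]
      have : a * d - p.1 * p.2 = 1 ↔ p.1 * p.2 = a * d - 1 := by
        constructor <;> intro h <;> linear_combination -h
      simp [this, and_assoc]
    rw [hset, this]
    simp [sub_eq_zero]
  · simp [R, hq]

theorem card_SL : Nat.card S = 4896 := by
  have := count (fun _ => True) (fun _ => True) false (by simp)
  rw [Nat.card_congr (Equiv.subtypeUnivEquiv (by simp))] at this
  rw [this]
  decide +kernel

theorem card_PSL : Nat.card PSL(2, ZMod 17) = 2448 := by
  have := card_lift (fun _ => True)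
  rw [Nat.card_congr (Equiv.subtypeUnivEquiv (by simp)),
    Nat.card_congr (Equiv.subtypeUnivEquiv (by simp)), card_SL] at this
  omega

theorem class_mul {G : Type*} [Group G] [Finite G] (x : G) :
    classSize x * Nat.card {y : G // y * x = x * y} = Nat.card G := by
  have := Nat.card_congr (MulAction.orbitProdStabilizerEquivGroup (ConjAct G) x)
  rw [Nat.card_prod] at this
  rw [show Nat.card G = Nat.card (ConjAct G) from rfl, ← this]
  congr 1
  · refine Nat.card_congr (Equiv.subtypeEquivRight fun y => ?_)
    rw [ConjAct.mem_orbit_conjAct, isConj_comm]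
  · refine Nat.card_congr (ConjAct.toConjAct.toEquiv.subtypeEquiv fun y => ?_)
    simp [MulAction.mem_stabilizer_iff, ConjAct.smul_def, mul_inv_eq_iff_eq_mul]

theorem mk_comm (A P : S) : ((QuotientGroup.mk P : PSL(2, ZMod 17)) * QuotientGroup.mk A =
    QuotientGroup.mk A * QuotientGroup.mk P) ↔ (P * A = A * P ∨ P * A = -(A * P)) := by
  rw [← QuotientGroup.mk_mul, ← QuotientGroup.mk_mul, eq_comm, QuotientGroup.eq, mem_center]
  rw [inv_mul_eq_iff_eq_mul, inv_mul_eq_iff_eq_mul]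
  simp

theorem class_lift (A : S) : classSize (QuotientGroup.mk A : PSL(2, ZMod 17)) *
    Nat.card {P : S // P * A = A * P ∨ P * A = -(A * P)} = 4896 := by
  have h := class_mul (QuotientGroup.mk A : PSL(2, ZMod 17))
  have h2 := card_lift (fun y => y * (QuotientGroup.mk A) = QuotientGroup.mk A * y)
  simp only [mk_comm] at h2
  rw [card_PSL] at h
  rw [← h2]
  linarith

theorem card_comm (A : S) (hA : ¬ (A = 1 ∨ A = -1)) :
    Nat.card {P : S // P * A = A * P} = N (A 0 0 + A 1 1) := by
  rw [central_iff] at hA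
  have hd := det_eq A
  rw [N, ← Fintype.card_subtype, ← Nat.card_eq_fintype_card]
  symm
  refine Nat.card_congr (Equiv.ofBijective (fun p => ⟨mk (p.1.1 + p.1.2 * A 0 0) (p.1.2 * A 0 1)
    (p.1.2 * A 1 0) (p.1.1 + p.1.2 * A 1 1) ?_, ?_⟩) ⟨?_, ?_⟩)
  · linear_combination p.2 + p.1.2 ^ 2 * hd
  · rw [eq_iff]
    simp [Matrix.mul_apply, Fin.sum_univ_two]
    refine ⟨?_, ?_, ?_, ?_⟩ <;> ring
  · rintro ⟨⟨a, b⟩, h⟩ ⟨⟨a', b'⟩, h'⟩ he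
    simp only [Subtype.mk.injEq, eq_iff] at he
    simp [mk] at he
    simp only [Subtype.mk.injEq, Prod.mk.injEq]
    grind
  · rintro ⟨P, hP⟩
    have hp := det_eq P
    rw [eq_iff] at hP
    simp [Matrix.mul_apply, Fin.sum_univ_two] at hP
    obtain ⟨h1, h2, h3, h4⟩ := hP
    have key : ∃ a b : F, P 0 0 = a + b * A 0 0 ∧ P 0 1 = b * A 0 1 ∧ P 1 0 = b * A 1 0 ∧
        P 1 1 = a + b * A 1 1 := by
      by_cases hb : A 0 1 = 0
      · by_cases hc : A 1 0 = 0
        · have had : A 0 0 - A 1 1 ≠ 0 := fun h => hA ⟨sub_eq_zero.1 h, hb, hc⟩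
          refine ⟨P 0 0 - (P 0 0 - P 1 1) / (A 0 0 - A 1 1) * A 0 0, (P 0 0 - P 1 1) / (A 0 0 - A 1 1), ?_, ?_, ?_, ?_⟩ <;> grind
        · refine ⟨P 0 0 - P 1 0 / A 1 0 * A 0 0, P 1 0 / A 1 0, ?_, ?_, ?_, ?_⟩ <;> grind
      · refine ⟨P 0 0 - P 0 1 / A 0 1 * A 0 0, P 0 1 / A 0 1, ?_, ?_, ?_, ?_⟩ <;> grind
    obtain ⟨a, b, e1, e2, e3, e4⟩ := key
    refine ⟨⟨(a, b), ?_⟩, ?_⟩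
    · rw [e1, e2, e3, e4] at hp
      linear_combination hp - b ^ 2 * hd
    · simp only [Subtype.mk.injEq]
      rw [eq_iff]
      simp [mk, e1, e2, e3, e4]

theorem two_ne : (2 : F) ≠ 0 := by decide

theorem anti_trace (A P : S) (h : P * A = -(A * P)) : A 0 0 + A 1 1 = 0 := by
  have hp := det_eq P
  rw [eq_iff] at h
  simp [Matrix.mul_apply, Fin.sum_univ_two] at h
  obtain ⟨h1, h2, h3, h4⟩ := h
  have : 2 * (A 0 0 + A 1 1) = 0 := by
    linear_combination (-2 * (A 0 0 + A 1 1)) * hp + P 1 1 * h1 - P 1 0 * h2 - P 0 1 * h3 + P 0 0 * h4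
  exact (mul_eq_zero.1 this).resolve_left two_ne

theorem exists_anti (A : S) (h : A 0 0 + A 1 1 = 0) : ∃ Q : S, Q * A = -(A * Q) := by
  have hd := det_eq A
  have h' : A 1 1 = - A 0 0 := by linear_combination h
  have h17 : (17 : F) = 0 := by decide
  by_cases hc : A 1 0 = 0
  · by_cases hb : A 0 1 = 0
    · refine ⟨mk 0 1 (-1) 0 (by simp), ?_⟩
      rw [eq_iff]
      simp [Matrix.mul_apply, Fin.sum_univ_two, hc, hb, h']
    · refine ⟨mk 4 0 (-8 * A 0 0 / A 0 1) (-4) (by linear_combination -h17), ?_⟩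
      rw [eq_iff]
      simp [Matrix.mul_apply, Fin.sum_univ_two, hc, h']
      clear h17
      refine ⟨?_, ?_, ?_⟩ <;> grind
  · refine ⟨mk 4 (-8 * A 0 0 / A 1 0) 0 (-4) (by linear_combination -h17), ?_⟩
    rw [eq_iff]
    simp [Matrix.mul_apply, Fin.sum_univ_two, h']
    clear h17
    refine ⟨?_, ?_, ?_⟩ <;> grind

theorem not_both (X : S) : X ≠ -X := by
  intro h
  have hd := det_eq X
  rw [eq_iff] at h
  simp at h
  obtain ⟨h1, h2, h3, h4⟩ := h
  have := two_ne
  grind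

theorem classSize_mk (A : S) (hA : ¬ (A = 1 ∨ A = -1)) :
    classSize (QuotientGroup.mk A : PSL(2, ZMod 17)) = s (A 0 0 + A 1 1) := by
  have h := class_lift A
  have hc := card_comm A hA
  by_cases ht : A 0 0 + A 1 1 = 0
  · obtain ⟨Q, hQ⟩ := exists_anti A ht
    have e : Nat.card {P : S // P * A = -(A * P)} = Nat.card {P : S // P * A = A * P} := by
      refine Nat.card_congr ((Equiv.mulLeft Q⁻¹).subtypeEquiv fun P => ?_)
      simp only [Equiv.coe_mulLeft]
      have hQ' : A * Q⁻¹ = -(Q⁻¹ * A) := by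
        have : Q⁻¹ * (Q * A) * Q⁻¹ = Q⁻¹ * (-(A * Q)) * Q⁻¹ := by rw [hQ]
        simpa [mul_assoc] using this
      rw [← mul_assoc A, hQ', mul_assoc, neg_mul, mul_assoc, ← mul_neg Q⁻¹, mul_right_inj]
    have hs : Nat.card {P : S // P * A = A * P ∨ P * A = -(A * P)} =
        Nat.card {P : S // P * A = A * P} + Nat.card {P : S // P * A = -(A * P)} := by
      classical
      rw [← Nat.card_sum]
      refine Nat.card_congr (subtypeOrEquiv _ _ ?_)
      rw [Pi.disjoint_iff]
      intro P
      rw [Prop.disjoint_iff]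
      by_contra hh
      exact not_both _ (hh.1.symm.trans hh.2)
    rw [hs, e, hc, ht, N_zero] at h
    rw [ht, show s 0 = 153 by decide]
    omega
  · have hs : Nat.card {P : S // P * A = A * P ∨ P * A = -(A * P)} =
        Nat.card {P : S // P * A = A * P} := by
      refine Nat.card_congr (Equiv.subtypeEquivRight fun P => ?_)
      constructor
      · rintro (h | h)
        · exact h
        · exact absurd (anti_trace A P h) ht
      · exact Or.inl
    rw [hs, hc] at h
    have h2 := s_mul_N _ ht
    refine Nat.eq_of_mul_eq_mul_right ?_ (h.trans h2.symm)
    rcases Nat.eq_zero_or_pos (N (A 0 0 + A 1 1)) with h0 | h0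
    · rw [h0] at h; simp at h
    · exact h0

theorem classSize_mk' (A : S) (hA : (A = 1 ∨ A = -1)) :
    classSize (QuotientGroup.mk A : PSL(2, ZMod 17)) = 1 := by
  have h := class_lift A
  rw [Nat.card_congr (Equiv.subtypeUnivEquiv (fun P => Or.inl ?_)), card_SL] at h
  · omega
  · rw [← mem_center, Subgroup.mem_center_iff] at hA
    exact hA P

theorem s_vals : ∀ t, s t = 153 ∨ s t = 144 ∨ s t = 306 ∨ s t = 272 := by decide +kernel

theorem cnt (n : ℕ) (hn : n ≠ 1) : 2 * sameSizeCount PSL(2, ZMod 17) n =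
    ∑ a : F, ∑ d : F, if s (a + d) = n then
      (if a * d = 1 then (if true = true ∧ a = d then 32 else 33) else 16) else 0 := by
  rw [sameSizeCount, card_lift, count _ (fun t => s t = n) true]
  intro A
  rw [← central_iff]
  by_cases hA : A = 1 ∨ A = -1
  · rw [classSize_mk' A hA]; simp [hA, hn.symm]
  · rw [classSize_mk A hA]; simp [hA]

theorem cnt1 : sameSizeCount PSL(2, ZMod 17) 1 = 1 := by
  have : 2 * sameSizeCount PSL(2, ZMod 17) 1 = 2 := by
    rw [sameSizeCount, card_lift]
    refine Eq.trans ?_ card_center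
    refine Nat.card_congr (Equiv.subtypeEquivRight fun A => ?_)
    rw [mem_center]
    by_cases hA : A = 1 ∨ A = -1
    · simp [classSize_mk' A hA, hA]
    · rw [classSize_mk A hA]
      have := s_vals (A 0 0 + A 1 1)
      simp only [hA, iff_false]
      omega
  omega

theorem cnt153 : sameSizeCount PSL(2, ZMod 17) 153 = 153 := by
  have := cnt 153 (by simp)
  have h2 : _ = 306 := this.symm.trans (this.trans (by decide +kernel))
  omega
theorem cnt144 : sameSizeCount PSL(2, ZMod 17) 144 = 288 := by
  have := cnt 144 (by simp)
  have h2 : _ = 576 := this.symm.trans (this.trans (by decide +kernel))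
  omega
theorem cnt306 : sameSizeCount PSL(2, ZMod 17) 306 = 918 := by
  have := cnt 306 (by simp)
  have h2 : _ = 1836 := this.symm.trans (this.trans (by decide +kernel))
  omega
theorem cnt272 : sameSizeCount PSL(2, ZMod 17) 272 = 1088 := by
  have := cnt 272 (by simp)
  have h2 : _ = 2176 := this.symm.trans (this.trans (by decide +kernel))
  omega

theorem exists_of {n m : ℕ} (h : sameSizeCount PSL(2, ZMod 17) n = m) (hm : m ≠ 0) :
    m ∈ sameSizeSet PSL(2, ZMod 17) := by
  have : Nonempty {x : PSL(2, ZMod 17) // classSize x = n} := by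
    by_contra hh
    rw [not_nonempty_iff] at hh
    rw [sameSizeCount, Nat.card_of_isEmpty] at h
    exact hm h.symm
  obtain ⟨x, hx⟩ := this
  exact ⟨x, by rw [hx, h]⟩

end PSL17

open PSL17 in
theorem stmt_13 : sameSizeSet (PSL(2, ZMod 17)) = {1, 153, 288, 918, 1088} := by
  ext m
  simp only [Set.mem_insert_iff, Set.mem_singleton_iff]
  constructor
  · rintro ⟨x, rfl⟩
    obtain ⟨A, rfl⟩ := QuotientGroup.mk_surjective x
    by_cases hA : A = 1 ∨ A = -1
    · rw [classSize_mk' A hA, cnt1]; simp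
    · rw [classSize_mk A hA]
      rcases s_vals (A 0 0 + A 1 1) with h | h | h | h <;> rw [h]
      · rw [cnt153]; simp
      · rw [cnt144]; simp
      · rw [cnt306]; simp
      · rw [cnt272]; simp
  · rintro (rfl | rfl | rfl | rfl | rfl)
    · exact exists_of cnt1 (by simp)
    · exact exists_of cnt153 (by simp)
    · exact exists_of cnt144 (by simp)
    · exact exists_of cnt306 (by simp)
    · exact exists_of cnt272 (by simp)
end
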